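/- Finite-time extinction of the cascaded α̌-subsystem of the observer error target system: let L > 0, ε₁, ε₂ > 0, a₁, a₂ ∈ ℝ, T ≥ 0, let λ : [0,L] → ℝ be continuous, and let α_s, α_f be C¹ on [0,L] × [0,∞) satisfying, for all x ∈ [0,L], t ≥ T: ∂_t α_s + ε₁ ∂_x α_s = a₁·α_s and ∂_t α_f + ε₂ ∂_x α_f = a₂·α_f, with boundary conditions α_s(0,t) = 0 and α_f(0,t) = −∫₀ᴸ λ(x)·α_s(x,t) dx for all t ≥ T. Then α_s(x,t) = 0 for every x ∈ [0,L] and every t ≥ T + x/ε₁, and α_f(x,t) = 0 for every x ∈ [0,L] and every t ≥ T + L/ε₁ + x/ε₂. -/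

import Mathlib

/-- A `C¹` solution of the transport equation `∂_t f + ε ∂_x f = a f` which vanishes on the inflow
boundary `x = 0` from time `T₀` on vanishes at `x` from time `T₀ + x / ε` on. -/
theorem transport_eq_zero_of_boundary_eq_zero {L ε a T T₀ : ℝ} (hε : 0 < ε) (hT : 0 ≤ T)
    (hTT₀ : T ≤ T₀) {f : ℝ → ℝ → ℝ}
    (hf : ContDiffOn ℝ 1 (Function.uncurry f) (Set.Icc 0 L ×ˢ Set.Ici 0))
    (hpde : ∀ x ∈ Set.Icc (0:ℝ) L, ∀ t ∈ Set.Ici T,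
      deriv (fun s => f x s) t + ε * deriv (fun y => f y t) x = a * f x t)
    (hbc : ∀ t, T₀ ≤ t → f 0 t = 0)
    {x : ℝ} (hx : x ∈ Set.Icc (0:ℝ) L) {t : ℝ} (ht : T₀ + x / ε ≤ t) : f x t = 0 := by
  obtain ⟨hx0, hxL⟩ := hx
  rcases hx0.eq_or_lt with rfl | hxpos
  · exact hbc t (by simpa using ht)
  have htime : ∀ s, T₀ + s / ε ≤ t + (s - x) / ε := fun s => by
    rw [sub_div]; linarith
  set c : ℝ → ℝ × ℝ := fun s => (s, t + (s - x) / ε) with hc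
  have hcont : ContinuousOn (fun s => Real.exp (-(a / ε) * s) * Function.uncurry f (c s))
      (Set.Icc 0 x) := by
    refine ContinuousOn.mul (by fun_prop) (hf.continuousOn.comp (by fun_prop) ?_)
    intro s hs
    have h1 := htime s
    have h2 : 0 ≤ s / ε := div_nonneg hs.1 hε.le
    exact ⟨⟨hs.1, hs.2.trans hxL⟩, show (0:ℝ) ≤ t + (s - x) / ε by linarith⟩
  have hderiv : ∀ s ∈ Set.Ioo 0 x,
      HasDerivAt (fun s => Real.exp (-(a / ε) * s) * Function.uncurry f (c s)) 0 s := by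
    intro s hs
    have h1 := htime s
    have h2 : 0 < s / ε := div_pos hs.1 hε
    have hsL : s < L := hs.2.trans_le hxL
    have hτ : 0 < t + (s - x) / ε := by linarith
    have hnhds : Set.Icc 0 L ×ˢ Set.Ici 0 ∈ nhds (c s) :=
      prod_mem_nhds (Icc_mem_nhds hs.1 hsL) (Ici_mem_nhds hτ)
    have hD := ((hf.contDiffAt hnhds).differentiableAt one_ne_zero).hasFDerivAt
    set D := fderiv ℝ (Function.uncurry f) (c s)
    have ht' : HasDerivAt (fun r => f s r) (D (0, 1)) (t + (s - x) / ε) :=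
      hD.comp_hasDerivAt (f := fun r : ℝ => (s, r)) _
        ((hasDerivAt_const _ s).prodMk (hasDerivAt_id _))
    have hx' : HasDerivAt (fun y => f y (t + (s - x) / ε)) (D (1, 0)) s :=
      hD.comp_hasDerivAt (f := fun y : ℝ => (y, t + (s - x) / ε)) _
        ((hasDerivAt_id _).prodMk (hasDerivAt_const _ _))
    have hc' : HasDerivAt c (1, 1 / ε) s :=
      (hasDerivAt_id s).prodMk ((((hasDerivAt_id s).sub_const x).div_const ε).const_add t)
    have hfc := hD.comp_hasDerivAt s hc'
    have hp := hpde s ⟨hs.1.le, hsL.le⟩ (t + (s - x) / ε) (show T ≤ _ by linarith)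
    rw [ht'.deriv, hx'.deriv] at hp
    have hsplit : D (1, 1 / ε) = D (1, 0) + (1 / ε) * D (0, 1) := by
      rw [← smul_eq_mul, ← map_smul, ← map_add]
      simp
    have hexp : HasDerivAt (fun s => Real.exp (-(a / ε) * s))
        (Real.exp (-(a / ε) * s) * (-(a / ε) * 1)) s :=
      ((hasDerivAt_id s).const_mul (-(a / ε))).exp
    refine (hexp.mul hfc).congr_deriv ?_
    have hval : D (1, 1 / ε) = a / ε * f s (t + (s - x) / ε) := by
      rw [hsplit, div_mul_eq_mul_div a, ← hp]
      field_simp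
      ring
    rw [hval]
    simp only [Function.comp_apply, hc, Function.uncurry_apply_pair]
    ring
  obtain ⟨s, -, hs⟩ := exists_hasDerivAt_eq_slope _ (fun _ => 0) hxpos hcont hderiv
  have h0 : f 0 (t + -x / ε) = 0 := hbc _ (by simpa using htime 0)
  have hne : x - 0 ≠ 0 := by simpa using hxpos.ne'
  rw [eq_div_iff hne] at hs
  simpa [hc, h0] using hs

/-- Finite-time extinction of the cascaded α̌-subsystem of the observer error
target system: α_s vanishes for t ≥ T + x/ε₁ and α_f for
t ≥ T + L/ε₁ + x/ε₂, under the integral boundary condition for α_f. -/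
theorem stmt_15
    (L ε₁ ε₂ a₁ a₂ T : ℝ) (hL : 0 < L) (hε₁ : 0 < ε₁) (hε₂ : 0 < ε₂) (hT : 0 ≤ T)
    (lam : ℝ → ℝ) (hlam : ContinuousOn lam (Set.Icc 0 L))
    (αs αf : ℝ → ℝ → ℝ)
    (hαs : ContDiffOn ℝ 1 (Function.uncurry αs) (Set.Icc 0 L ×ˢ Set.Ici 0))
    (hαf : ContDiffOn ℝ 1 (Function.uncurry αf) (Set.Icc 0 L ×ˢ Set.Ici 0))
    (hpde_s : ∀ x ∈ Set.Icc (0:ℝ) L, ∀ t ∈ Set.Ici T,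
      deriv (fun s => αs x s) t + ε₁ * deriv (fun y => αs y t) x = a₁ * αs x t)
    (hpde_f : ∀ x ∈ Set.Icc (0:ℝ) L, ∀ t ∈ Set.Ici T,
      deriv (fun s => αf x s) t + ε₂ * deriv (fun y => αf y t) x = a₂ * αf x t)
    (hbc_s : ∀ t ∈ Set.Ici T, αs 0 t = 0)
    (hbc_f : ∀ t ∈ Set.Ici T, αf 0 t = -∫ x in (0:ℝ)..L, lam x * αs x t) :
    (∀ x ∈ Set.Icc (0:ℝ) L, ∀ t : ℝ, T + x / ε₁ ≤ t → αs x t = 0) ∧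
    (∀ x ∈ Set.Icc (0:ℝ) L, ∀ t : ℝ, T + L / ε₁ + x / ε₂ ≤ t → αf x t = 0) := by
  have hs : ∀ x ∈ Set.Icc (0:ℝ) L, ∀ t : ℝ, T + x / ε₁ ≤ t → αs x t = 0 :=
    fun x hx t ht =>
      transport_eq_zero_of_boundary_eq_zero hε₁ hT le_rfl hαs hpde_s hbc_s hx ht
  have hLε : 0 ≤ L / ε₁ := by positivity
  refine ⟨hs, fun x hx t ht =>
    transport_eq_zero_of_boundary_eq_zero hε₂ hT (by linarith) hαf hpde_f (fun r hr => ?_) hx ht⟩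
  rw [hbc_f r (show T ≤ r by linarith), neg_eq_zero]
  refine intervalIntegral.integral_zero_ae (Filter.Eventually.of_forall fun y hy => ?_)
  rw [Set.uIoc_of_le hL.le] at hy
  have hyL : y / ε₁ ≤ L / ε₁ := by gcongr; exact hy.2
  rw [hs y ⟨hy.1.le, hy.2⟩ r (by linarith), mul_zero]
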